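/- arXiv:1405.2590 — 5 statements merged into one kernel-verified Lean document; each statement's English description precedes it below -/
import Mathlib

section
/- For every ground program P over a type α of atoms, the sequence of true (known) sets of the alternating fixpoint procedure is increasing: K_i ⊆ K_{i+1} for all i ≥ 0. -/
/-- A ground rule: head atom, finite set of positive subgoals, finite set of negative subgoals. -/
structure GroundRule (α : Type*) where
  head : α
  pos : Finset α
  neg : Finset α

/-- The extended immediate consequence operator `T_{P,J}(I)`. -/
def Tstep {α : Type*} (P : Set (GroundRule α)) (J I : Set α) : Set α :=
  {a | ∃ r ∈ P, r.head = a ∧ ↑r.pos ⊆ I ∧ (↑r.neg ∩ J : Set α) = ∅}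

lemma Tstep_mono {α : Type*} (P : Set (GroundRule α)) (J : Set α) : Monotone (Tstep P J) := by
  rintro I I' h a ⟨r, hr, hh, hpos, hneg⟩
  exact ⟨r, hr, hh, hpos.trans h, hneg⟩

/-- `T_{P,J}` bundled as a monotone map on the complete lattice of subsets of `α`. -/
def TstepHom {α : Type*} (P : Set (GroundRule α)) (J : Set α) : Set α →o Set α :=
  ⟨Tstep P J, Tstep_mono P J⟩

/-- The least fixed point of `I ↦ T_{P,J}(I)` (Knaster–Tarski). -/
def Tlfp {α : Type*} (P : Set (GroundRule α)) (J : Set α) : Set α :=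
  OrderHom.lfp (TstepHom P J)

/-- The definite part `P⁺` of `P`: the rules with no negative subgoals. -/
def definitePart {α : Type*} (P : Set (GroundRule α)) : Set (GroundRule α) :=
  {r ∈ P | r.neg = ∅}

/-- The alternating fixpoint sequence `(K_i, U_i)`:
`K₀ := lfp (T_{P⁺,∅})`, `U₀ := lfp (T_{P,K₀})`, and for `i > 0`,
`K_i := lfp (T_{P,U_{i-1}})`, `U_i := lfp (T_{P,K_i})`. -/
def AFP {α : Type*} (P : Set (GroundRule α)) : ℕ → Set α × Set α
  | 0 => (Tlfp (definitePart P) ∅, Tlfp P (Tlfp (definitePart P) ∅))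
  | i + 1 => (Tlfp P (AFP P i).2, Tlfp P (Tlfp P (AFP P i).2))

/-- The true (known) sets `K_i` of the alternating fixpoint procedure. -/
def Kseq {α : Type*} (P : Set (GroundRule α)) (i : ℕ) : Set α := (AFP P i).1

/-- The possible (unknown) sets `U_i` of the alternating fixpoint procedure. -/
def Useq {α : Type*} (P : Set (GroundRule α)) (i : ℕ) : Set α := (AFP P i).2

lemma Tlfp_antitone {α : Type*} (P : Set (GroundRule α)) : Antitone (Tlfp P) := by
  intro J J' h
  refine OrderHom.lfp.monotone fun I a => ?_
  rintro ⟨r, hr, hh, hpos, hneg⟩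
  exact ⟨r, hr, hh, hpos, Set.subset_eq_empty (Set.inter_subset_inter_right _ h) hneg⟩

lemma Tlfp_definitePart_subset {α : Type*} (P : Set (GroundRule α)) (J J' : Set α) :
    Tlfp (definitePart P) J ⊆ Tlfp P J' := by
  refine OrderHom.lfp.monotone fun I a => ?_
  rintro ⟨r, ⟨hr, hdef⟩, hh, hpos, -⟩
  exact ⟨r, hr, hh, hpos, by simp [hdef]⟩

lemma Useq_eq_Tlfp_Kseq {α : Type*} (P : Set (GroundRule α)) (i : ℕ) :
    Useq P i = Tlfp P (Kseq P i) := by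
  cases i <;> rfl

/-- The sequence of true (known) sets of the alternating fixpoint procedure is increasing. -/
theorem Kseq_increasing {α : Type*} (P : Set (GroundRule α)) (i : ℕ) :
    Kseq P i ⊆ Kseq P (i + 1) := by
  induction i with
  | zero => exact Tlfp_definitePart_subset P _ _
  | succ i ih =>
    change Tlfp P (Useq P i) ⊆ Tlfp P (Useq P (i + 1))
    rw [Useq_eq_Tlfp_Kseq, Useq_eq_Tlfp_Kseq]
    exact Tlfp_antitone P (Tlfp_antitone P ih)
end

section
/- For every ground program P over a type α of atoms, the true sets of the alternating fixpoint procedure are contained in the corresponding unknown sets: K_i ⊆ U_i for all i ≥ 0. -/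
lemma Tstep_antitone {α : Type*} (P : Set (GroundRule α)) {J J' : Set α} (h : J ⊆ J')
    (I : Set α) : Tstep P J' I ⊆ Tstep P J I := by
  rintro a ⟨r, hr, hh, hpos, hneg⟩
  exact ⟨r, hr, hh, hpos,
    Set.subset_eq_empty (Set.inter_subset_inter_right _ h) hneg⟩

lemma Tstep_definitePart_subset {α : Type*} (P : Set (GroundRule α)) (J J' I : Set α) :
    Tstep (definitePart P) J I ⊆ Tstep P J' I := by
  rintro a ⟨r, ⟨hr, hn⟩, hh, hpos, -⟩
  exact ⟨r, hr, hh, hpos, by simp [hn]⟩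

/-- The true sets are contained in the corresponding unknown sets. -/
theorem Kseq_subset_Useq {α : Type*} (P : Set (GroundRule α)) (i : ℕ) :
    Kseq P i ⊆ Useq P i := by
  induction i with
  | zero => exact Tlfp_definitePart_subset P _ _
  | succ i ih =>
    have hU : Useq P i = Tlfp P (Kseq P i) := by cases i <;> rfl
    have h : Tlfp P (Useq P i) ⊆ Useq P i := (Tlfp_antitone P ih).trans hU.ge
    exact Tlfp_antitone P h
end

section
/- Let L be a complete lattice, let f : L → L be monotone, and let a ∈ L satisfy a ≤ lfp f. Then a ⊔ lfp(x ↦ f(a ⊔ x)) = lfp f. (This is the correctness of the optimized least fixpoint computation that starts from a previously computed lower bound a and returns only the newly inferred part.) -/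
/-- Correctness of the optimized least-fixpoint computation: starting from a previously
computed lower bound `a ≤ lfp f` and adjoining the least fixed point of `x ↦ f (a ⊔ x)`
recovers `lfp f`. -/
theorem opt_lfp_correct {L : Type*} [CompleteLattice L] (f : L →o L) (a : L)
    (ha : a ≤ OrderHom.lfp f) :
    a ⊔ OrderHom.lfp ⟨fun x => f (a ⊔ x), fun _ _ h => f.mono (sup_le_sup_left h a)⟩
      = OrderHom.lfp f := by
  apply le_antisymm
  · refine sup_le ha (OrderHom.lfp_le _ ?_)
    change f (a ⊔ OrderHom.lfp f) ≤ OrderHom.lfp f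
    rw [sup_eq_right.mpr ha, OrderHom.map_lfp]
  · refine OrderHom.lfp_le _ (le_trans ?_ le_sup_right)
    exact (OrderHom.map_lfp
      (⟨fun x => f (a ⊔ x), fun _ _ h => f.mono (sup_le_sup_left h a)⟩ : L →o L)).le
end

section
/- For every ground program P over a type α of atoms and every pair (T, F) of sets of atoms, the union of any family of sets that are each unfounded with respect to (T, F) is itself unfounded with respect to (T, F); consequently the union U_P(T,F) of all sets unfounded with respect to (T, F) is the greatest unfounded set of P with respect to (T, F). -/
/-- A set `A` of atoms is unfounded with respect to the partial interpretation `(Tset, Fset)`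
if every rule of `P` whose head lies in `A` has a positive subgoal in `Fset`, or a negative
subgoal in `Tset`, or a positive subgoal in `A`. -/
def Unfounded {α : Type*} (P : Set (GroundRule α)) (Tset Fset A : Set α) : Prop :=
  ∀ r ∈ P, r.head ∈ A →
    (∃ b ∈ r.pos, b ∈ Fset) ∨ (∃ b ∈ r.neg, b ∈ Tset) ∨ (∃ b ∈ r.pos, b ∈ A)

/-- The union `U_P(T,F)` of all sets unfounded with respect to `(Tset, Fset)`. -/
def UP {α : Type*} (P : Set (GroundRule α)) (Tset Fset : Set α) : Set α :=
  ⋃₀ {A | Unfounded P Tset Fset A}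

/-- The union of any family of unfounded sets is unfounded. -/
theorem Unfounded.sUnion {α : Type*} {P : Set (GroundRule α)} {Tset Fset : Set α}
    {𝒜 : Set (Set α)} (h𝒜 : ∀ A ∈ 𝒜, Unfounded P Tset Fset A) :
    Unfounded P Tset Fset (⋃₀ 𝒜) := by
  rintro r hr ⟨A, hA, hrA⟩
  exact (h𝒜 A hA r hr hrA).imp_right
    (Or.imp_right fun ⟨b, hb, hbA⟩ => ⟨b, hb, A, hA, hbA⟩)

/-- The union of any family of unfounded sets is unfounded; consequently `U_P(T,F)`,
the union of all unfounded sets, is the greatest unfounded set of `P` w.r.t. `(T,F)`. -/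
theorem unfounded_sUnion_and_greatest {α : Type*} (P : Set (GroundRule α))
    (Tset Fset : Set α) :
    (∀ 𝒜 : Set (Set α), (∀ A ∈ 𝒜, Unfounded P Tset Fset A) →
      Unfounded P Tset Fset (⋃₀ 𝒜)) ∧
    Unfounded P Tset Fset (UP P Tset Fset) ∧
    (∀ A : Set α, Unfounded P Tset Fset A → A ⊆ UP P Tset Fset) :=
  ⟨fun _ => Unfounded.sUnion, Unfounded.sUnion fun _ => id,
    fun _ hA => Set.subset_sUnion_of_mem hA⟩
end

section
/- For every ground program P over a type α of atoms, the operator W_P on pairs of sets of atoms, defined by W_P(T,F) := ({a : α | there is a rule in P with head a, pos ⊆ T and neg ⊆ F}, U_P(T,F)), is monotone on the product lattice Set α × Set α ordered componentwise by inclusion: if T ⊆ T' and F ⊆ F' then both components of W_P(T,F) are contained in the corresponding components of W_P(T',F'). -/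
/-- The operator `W_P(T,F) := ({a | some rule with head a has pos ⊆ T and neg ⊆ F}, U_P(T,F))`
on pairs of sets of atoms. -/
def WP {α : Type*} (P : Set (GroundRule α)) : Set α × Set α → Set α × Set α :=
  fun TF =>
    ({a | ∃ r ∈ P, r.head = a ∧ ↑r.pos ⊆ TF.1 ∧ ↑r.neg ⊆ TF.2}, UP P TF.1 TF.2)

/-- A set unfounded with respect to a partial interpretation stays unfounded when the
interpretation is enlarged. -/
theorem Unfounded.mono {α : Type*} {P : Set (GroundRule α)} {T T' F F' A : Set α}
    (hT : T ⊆ T') (hF : F ⊆ F') (hA : Unfounded P T F A) : Unfounded P T' F' A :=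
  fun r hr hh => (hA r hr hh).imp (fun ⟨b, hb, h⟩ => ⟨b, hb, hF h⟩)
    (Or.imp_left fun ⟨b, hb, h⟩ => ⟨b, hb, hT h⟩)

theorem UP_mono {α : Type*} (P : Set (GroundRule α)) {T T' F F' : Set α}
    (hT : T ⊆ T') (hF : F ⊆ F') : UP P T F ⊆ UP P T' F' :=
  Set.sUnion_subset_sUnion fun _ hA => Unfounded.mono hT hF hA

/-- The operator `W_P` is monotone on the product lattice `Set α × Set α` ordered
componentwise by inclusion. -/
theorem WP_monotone {α : Type*} (P : Set (GroundRule α))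
    (T T' F F' : Set α) (hT : T ⊆ T') (hF : F ⊆ F') :
    (WP P (T, F)).1 ⊆ (WP P (T', F')).1 ∧ (WP P (T, F)).2 ⊆ (WP P (T', F')).2 := by
  refine ⟨?_, UP_mono P hT hF⟩
  rintro a ⟨r, hr, ha, hpos, hneg⟩
  exact ⟨r, hr, ha, hpos.trans hT, hneg.trans hF⟩
end
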